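/- Fix integers N_x, N_y ≥ 1 and positive reals Δx, Δy, Δt, Pe_s, Pe_φ, Pe_ψ, and let E^h : ℝ^{N_x×N_y} × ℝ^{N_x×N_y} × ℝ^{N_x} → ℝ be an arbitrary function. Assume 0 ≤ ψ^k_{i,j} ≤ 1 for all 1 ≤ i ≤ N_x, 1 ≤ j ≤ N_y. If u* = (φ*, m^x_{φ*}, m^y_{φ*}, ψ*, m^x_{ψ*}, m^y_{ψ*}, φ*_bc) is admissible and satisfies J(u*) ≤ J(u) for every admissible tuple u, then the surfactant bounds are preserved: 0 ≤ ψ*_{i,j} ≤ 1 for all 1 ≤ i ≤ N_x, 1 ≤ j ≤ N_y. -/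

import Mathlib

open scoped Classical

/-- Extended-real-valued transport cost D_M(ρ, (mx, my)) = ‖m‖²/M(ρ) associated
with a mobility function M, with value 0 when M(ρ) = 0 and m = 0, and +∞
otherwise. -/
noncomputable def Dcost (M : ℝ → ℝ) (ρ mx my : ℝ) : EReal :=
  if 0 < M ρ then (((mx ^ 2 + my ^ 2) / M ρ : ℝ) : EReal)
  else if M ρ = 0 ∧ mx = 0 ∧ my = 0 then 0
  else ⊤

/-- Admissibility of a density/momentum pair: the central-difference discrete
continuity equation holds in the interior, together with the reflected
ghost-value (no-flux) boundary conditions. -/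
def Admissible (Nx Ny : ℕ) (Δx Δy : ℝ) (ρk ρ mx my : ℕ → ℕ → ℝ) : Prop :=
  (∀ i ∈ Finset.Icc 1 Nx, ∀ j ∈ Finset.Icc 1 Ny,
    ρ i j + (1 / (2 * Δx)) * (mx (i + 1) j - mx (i - 1) j)
      + (1 / (2 * Δy)) * (my i (j + 1) - my i (j - 1)) = ρk i j) ∧
  (∀ j ∈ Finset.Icc 1 Ny, mx 0 j = - mx 1 j ∧ mx (Nx + 1) j = - mx Nx j) ∧
  (∀ i ∈ Finset.Icc 1 Nx, my i 0 = - my i 1 ∧ my i (Ny + 1) = - my i Ny)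

/-- The extended-real-valued objective of the full-discrete JKO scheme for the
PFS-MCL model. -/
noncomputable def Jfun (Nx Ny : ℕ) (Δx Δy Δt Pes Peφ Peψ : ℝ)
    (Eh : (ℕ → ℕ → ℝ) → (ℕ → ℕ → ℝ) → (ℕ → ℝ) → ℝ) (φkbc : ℕ → ℝ)
    (φ mxφ myφ ψ mxψ myψ : ℕ → ℕ → ℝ) (φbc : ℕ → ℝ) : EReal :=
  ((1 / 2 : ℝ) : EReal) *
    (∑ i ∈ Finset.Icc 1 Nx, ∑ j ∈ Finset.Icc 1 Ny,
      (Dcost (fun _ => 1 / Peφ) (φ i j) (mxφ i j) (myφ i j)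
        + Dcost (fun s => s * (1 - s) / Peψ) (ψ i j) (mxψ i j) (myψ i j)))
    * ((Δx * Δy : ℝ) : EReal)
  + ((Pes / 2 * ∑ i ∈ Finset.Icc 1 Nx, (φbc i - φkbc i) ^ 2 * Δx : ℝ) : EReal)
  + ((Δt * Eh φ ψ φbc : ℝ) : EReal)

lemma Dcost_nonneg (M : ℝ → ℝ) (ρ mx my : ℝ) : 0 ≤ Dcost M ρ mx my := by
  unfold Dcost
  split_ifs with h
  · exact EReal.coe_nonneg.mpr (by positivity)
  · exact le_rfl
  · exact le_top

lemma Dcost_zero_momentum {M : ℝ → ℝ} {ρ : ℝ} (h : 0 ≤ M ρ) : Dcost M ρ 0 0 = 0 := by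
  unfold Dcost
  rcases h.lt_or_eq with h | h
  · simp [h]
  · simp [← h]

lemma Dcost_of_mobility_neg {M : ℝ → ℝ} {ρ : ℝ} (h : M ρ < 0) (mx my : ℝ) :
    Dcost M ρ mx my = ⊤ := by
  simp [Dcost, h.not_gt, h.ne]

lemma admissible_zero_momentum (Nx Ny : ℕ) (Δx Δy : ℝ) (ρ : ℕ → ℕ → ℝ) :
    Admissible Nx Ny Δx Δy ρ ρ (fun _ _ => 0) (fun _ _ => 0) := by
  simp [Admissible]

/-- The objective is finite at the previous time step transported by zero momentum. -/
lemma Jfun_zero_momentum_lt_top (Nx Ny : ℕ) (Δx Δy Δt Pes : ℝ) {Peφ Peψ : ℝ}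
    (hPeφ : 0 < Peφ) (hPeψ : 0 < Peψ)
    (Eh : (ℕ → ℕ → ℝ) → (ℕ → ℕ → ℝ) → (ℕ → ℝ) → ℝ) (φkbc φbc : ℕ → ℝ)
    (φ ψ : ℕ → ℕ → ℝ)
    (hψ : ∀ i ∈ Finset.Icc 1 Nx, ∀ j ∈ Finset.Icc 1 Ny, 0 ≤ ψ i j ∧ ψ i j ≤ 1) :
    Jfun Nx Ny Δx Δy Δt Pes Peφ Peψ Eh φkbc φ (fun _ _ => 0) (fun _ _ => 0)
      ψ (fun _ _ => 0) (fun _ _ => 0) φbc < ⊤ := by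
  have hsum : (∑ i ∈ Finset.Icc 1 Nx, ∑ j ∈ Finset.Icc 1 Ny,
      (Dcost (fun _ => 1 / Peφ) (φ i j) 0 0
        + Dcost (fun s => s * (1 - s) / Peψ) (ψ i j) 0 0)) = 0 := by
    refine Finset.sum_eq_zero fun i hi => Finset.sum_eq_zero fun j hj => ?_
    obtain ⟨h0, h1⟩ := hψ i hi j hj
    rw [Dcost_zero_momentum (by positivity), Dcost_zero_momentum, add_zero]
    exact div_nonneg (mul_nonneg h0 (sub_nonneg.mpr h1)) hPeψ.le
  unfold Jfun
  rw [hsum, mul_zero, zero_mul, zero_add, ← EReal.coe_add]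
  exact EReal.coe_lt_top _

/-- The objective is infinite as soon as the surfactant mobility is negative at a grid point. -/
lemma Jfun_eq_top_of_mobility_neg {Nx Ny : ℕ} {Δx Δy : ℝ} (Δt Pes Peφ Peψ : ℝ)
    (hΔx : 0 < Δx) (hΔy : 0 < Δy)
    (Eh : (ℕ → ℕ → ℝ) → (ℕ → ℕ → ℝ) → (ℕ → ℝ) → ℝ) (φkbc : ℕ → ℝ)
    (φ mxφ myφ ψ mxψ myψ : ℕ → ℕ → ℝ) (φbc : ℕ → ℝ) {i j : ℕ}
    (hi : i ∈ Finset.Icc 1 Nx) (hj : j ∈ Finset.Icc 1 Ny)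
    (hneg : ψ i j * (1 - ψ i j) / Peψ < 0) :
    Jfun Nx Ny Δx Δy Δt Pes Peφ Peψ Eh φkbc φ mxφ myφ ψ mxψ myψ φbc = ⊤ := by
  let f : ℕ → ℕ → EReal := fun i j =>
    Dcost (fun _ => 1 / Peφ) (φ i j) (mxφ i j) (myφ i j)
      + Dcost (fun s => s * (1 - s) / Peψ) (ψ i j) (mxψ i j) (myψ i j)
  have hf : ∀ i j, 0 ≤ f i j := fun i j => add_nonneg (Dcost_nonneg ..) (Dcost_nonneg ..)
  have htop : f i j = ⊤ := by
    simp only [f]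
    rw [Dcost_of_mobility_neg (M := fun s => s * (1 - s) / Peψ) hneg]
    exact EReal.add_top_of_ne_bot (ne_of_gt (EReal.bot_lt_zero.trans_le (Dcost_nonneg ..)))
  have hsum : (∑ i ∈ Finset.Icc 1 Nx, ∑ j ∈ Finset.Icc 1 Ny, f i j) = ⊤ := by
    refine top_le_iff.mp (htop ▸ ?_)
    exact (Finset.single_le_sum (f := f i) (fun j _ => hf i j) hj).trans
      (Finset.single_le_sum (f := fun i => ∑ j ∈ Finset.Icc 1 Ny, f i j)
        (fun i _ => Finset.sum_nonneg fun j _ => hf i j) hi)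
  unfold Jfun
  rw [hsum, EReal.coe_mul_top_of_pos (by norm_num), EReal.top_mul_coe_of_pos (by positivity),
    EReal.top_add_coe, EReal.top_add_coe]

/-- Bound preservation for the full-discrete JKO scheme: any global minimizer of
the objective among admissible tuples keeps the surfactant concentration within
the bounds 0 ≤ ψ* ≤ 1. -/
theorem stmt_2 (Nx Ny : ℕ) (hNx : 1 ≤ Nx) (hNy : 1 ≤ Ny)
    (Δx Δy Δt Pes Peφ Peψ : ℝ)
    (hΔx : 0 < Δx) (hΔy : 0 < Δy) (hΔt : 0 < Δt)
    (hPes : 0 < Pes) (hPeφ : 0 < Peφ) (hPeψ : 0 < Peψ)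
    (Eh : (ℕ → ℕ → ℝ) → (ℕ → ℕ → ℝ) → (ℕ → ℝ) → ℝ)
    (φk ψk : ℕ → ℕ → ℝ) (φkbc : ℕ → ℝ)
    (hψk : ∀ i ∈ Finset.Icc 1 Nx, ∀ j ∈ Finset.Icc 1 Ny,
      0 ≤ ψk i j ∧ ψk i j ≤ 1)
    (φs mxφs myφs ψs mxψs myψs : ℕ → ℕ → ℝ) (φbcs : ℕ → ℝ)
    (hadmφ : Admissible Nx Ny Δx Δy φk φs mxφs myφs)
    (hadmψ : Admissible Nx Ny Δx Δy ψk ψs mxψs myψs)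
    (hmin : ∀ (φ mxφ myφ ψ mxψ myψ : ℕ → ℕ → ℝ) (φbc : ℕ → ℝ),
      Admissible Nx Ny Δx Δy φk φ mxφ myφ →
      Admissible Nx Ny Δx Δy ψk ψ mxψ myψ →
      Jfun Nx Ny Δx Δy Δt Pes Peφ Peψ Eh φkbc φs mxφs myφs ψs mxψs myψs φbcs ≤
        Jfun Nx Ny Δx Δy Δt Pes Peφ Peψ Eh φkbc φ mxφ myφ ψ mxψ myψ φbc) :
    ∀ i ∈ Finset.Icc 1 Nx, ∀ j ∈ Finset.Icc 1 Ny,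
      0 ≤ ψs i j ∧ ψs i j ≤ 1 := by
  intro i hi j hj
  have hfin := (hmin _ _ _ _ _ _ _ (admissible_zero_momentum Nx Ny Δx Δy φk)
    (admissible_zero_momentum Nx Ny Δx Δy ψk)).trans_lt
      (Jfun_zero_momentum_lt_top Nx Ny Δx Δy Δt Pes hPeφ hPeψ Eh φkbc φkbc φk ψk hψk)
  have hmob : 0 ≤ ψs i j * (1 - ψs i j) / Peψ := by
    by_contra! hneg
    exact hfin.ne (Jfun_eq_top_of_mobility_neg Δt Pes Peφ Peψ hΔx hΔy Eh φkbc
      φs mxφs myφs ψs mxψs myψs φbcs hi hj hneg)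
  have hprod : 0 ≤ ψs i j * (1 - ψs i j) := by
    simpa [hPeψ.ne'] using mul_nonneg hmob hPeψ.le
  constructor <;> nlinarith
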